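/- A finitely complete category C is diexact if and only if C is Barr-exact and amalgamable. -/

import Mathlib

open CategoryTheory CategoryTheory.Limits

universe v u

section Defs

variable {C : Type u} [Category.{v} C]

/-- A span `(f, g)` is *jointly monic* if `u ≫ f = v ≫ f` and `u ≫ g = v ≫ g` imply `u = v`
(equivalently, the induced map into the product is a monomorphism). -/
def JointlyMonic {Z A B : C} (f : Z ⟶ A) (g : Z ⟶ B) : Prop :=
  ∀ ⦃X : C⦄ (u v : X ⟶ Z), u ≫ f = v ≫ f → u ≫ g = v ≫ g → u = v

/-- `(P, π₁, π₂, π₃)` is the limit `C ×_B C ×_A C` of triples `(c₁, c₂, c₃)` of generalized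
elements of `Z` with `g ∘ π₁ = g ∘ π₂` and `f ∘ π₂ = f ∘ π₃`. -/
structure IsTripleLimit {Z A B : C} (f : Z ⟶ A) (g : Z ⟶ B) {P : C}
    (π₁ π₂ π₃ : P ⟶ Z) : Prop where
  w₁ : π₁ ≫ g = π₂ ≫ g
  w₂ : π₂ ≫ f = π₃ ≫ f
  lift : ∀ ⦃X : C⦄ (x₁ x₂ x₃ : X ⟶ Z), x₁ ≫ g = x₂ ≫ g → x₂ ≫ f = x₃ ≫ f →
    ∃! u : X ⟶ P, u ≫ π₁ = x₁ ∧ u ≫ π₂ = x₂ ∧ u ≫ π₃ = x₃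

/-- A jointly monic span `(f, g)` is a *Mal'cev span* if, for the limit
`P = C ×_B C ×_A C`, there exists `p : P ⟶ C` with `f ∘ p = f ∘ π₁` and `g ∘ p = g ∘ π₃`. -/
def IsMalcevSpan {Z A B : C} (f : Z ⟶ A) (g : Z ⟶ B) : Prop :=
  JointlyMonic f g ∧
  ∀ ⦃P : C⦄ (π₁ π₂ π₃ : P ⟶ Z), IsTripleLimit f g π₁ π₂ π₃ →
    ∃ p : P ⟶ Z, p ≫ f = π₁ ≫ f ∧ p ≫ g = π₃ ≫ g

/-- A commuting square (with legs `f, g` and colegs `h, k`) is *stable under pullback* if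
every commutative cube over it whose four side faces are pullbacks has a pushout top face. -/
def PushoutStable {Z A B D : C} (f : Z ⟶ A) (g : Z ⟶ B) (h : A ⟶ D) (k : B ⟶ D) : Prop :=
  ∀ ⦃Z' A' B' D' : C⦄ (f' : Z' ⟶ A') (g' : Z' ⟶ B') (h' : A' ⟶ D') (k' : B' ⟶ D')
    (αZ : Z' ⟶ Z) (αA : A' ⟶ A) (αB : B' ⟶ B) (αD : D' ⟶ D),
    IsPullback f' αZ αA f → IsPullback g' αZ αB g →
    IsPullback h' αA αD h → IsPullback k' αB αD k →
    f' ≫ h' = g' ≫ k' → IsPushout f' g' h' k'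

/-- A category is *diexact* if every Mal'cev span admits a pushout, and every pushout square
of a Mal'cev span is stable under pullback and is itself a pullback square. -/
def Diexact (C : Type u) [Category.{v} C] : Prop :=
  ∀ ⦃Z A B : C⦄ (f : Z ⟶ A) (g : Z ⟶ B), IsMalcevSpan f g →
    (∃ (D : C) (h : A ⟶ D) (k : B ⟶ D), IsPushout f g h k) ∧
    ∀ ⦃D : C⦄ (h : A ⟶ D) (k : B ⟶ D), IsPushout f g h k →
      PushoutStable f g h k ∧ IsPullback f g h k

/-- An internal equivalence relation: a jointly monic pair which is reflexive, symmetric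
and transitive. -/
def IsEquivRelation [HasPullbacks C] {E A : C} (s t : E ⟶ A) : Prop :=
  JointlyMonic s t ∧
  (∃ r : A ⟶ E, r ≫ s = 𝟙 A ∧ r ≫ t = 𝟙 A) ∧
  (∃ σ : E ⟶ E, σ ≫ s = t ∧ σ ≫ t = s) ∧
  (∃ τ : pullback t s ⟶ E,
     τ ≫ s = pullback.fst t s ≫ s ∧ τ ≫ t = pullback.snd t s ≫ t)

/-- A finitely complete category is *Barr-exact* if every kernel pair has a coequaliser,
regular epimorphisms are stable under pullback, and every internal equivalence relation is
effective (i.e. a kernel pair). -/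
def BarrExact (C : Type u) [Category.{v} C] [HasFiniteLimits C] : Prop :=
  (∀ ⦃X Y : C⦄ (f : X ⟶ Y), HasCoequalizer (pullback.fst f f) (pullback.snd f f)) ∧
  (∀ ⦃X Y W : C⦄ (f : X ⟶ Y) (g : W ⟶ Y),
     Nonempty (RegularEpi f) → Nonempty (RegularEpi (pullback.snd f g))) ∧
  (∀ ⦃E A : C⦄ (s t : E ⟶ A), IsEquivRelation s t →
     ∃ (Q : C) (q : A ⟶ Q), IsPullback s t q q)

/-- A category is *amalgamable* if every span of monomorphisms admits a pushout which is
stable under pullback and is itself a pullback square. -/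
def Amalgamable (C : Type u) [Category.{v} C] : Prop :=
  ∀ ⦃Z A B : C⦄ (f : Z ⟶ A) (g : Z ⟶ B), Mono f → Mono g →
    ∃ (D : C) (h : A ⟶ D) (k : B ⟶ D),
      IsPushout f g h k ∧ PushoutStable f g h k ∧ IsPullback f g h k

/-- A category is *adhesive* if it admits pushouts along monomorphisms, and these pushouts
are stable under pullback and are pullback squares. -/
def AdhesiveCat (C : Type u) [Category.{v} C] : Prop :=
  ∀ ⦃Z A B : C⦄ (f : Z ⟶ A) (g : Z ⟶ B), Mono f →
    (∃ (D : C) (h : A ⟶ D) (k : B ⟶ D), IsPushout f g h k) ∧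
    ∀ ⦃D : C⦄ (h : A ⟶ D) (k : B ⟶ D), IsPushout f g h k →
      PushoutStable f g h k ∧ IsPullback f g h k

/-- `u` factors through `v` (as morphisms into a common object `X`). -/
def FactorsThru {U V X : C} (u : U ⟶ X) (v : V ⟶ X) : Prop :=
  ∃ w : U ⟶ V, w ≫ v = u

/-- A monomorphism `m : P ⟶ X` is the *union* of the subobjects `a : A ⟶ X` and `b : B ⟶ X`:
both factor through `m`, and `m` factors through any monomorphism through which both factor. -/
def IsUnionOf {A B P X : C} (a : A ⟶ X) (b : B ⟶ X) (m : P ⟶ X) : Prop :=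
  Mono m ∧ FactorsThru a m ∧ FactorsThru b m ∧
  ∀ ⦃Q : C⦄ (c : Q ⟶ X), Mono c → FactorsThru a c → FactorsThru b c → FactorsThru m c

end Defs

section Coverage

variable {C : Type u} [Category.{v} C]

/-- `S` holds *locally* on `T` if the morphisms into `T` satisfying `S` form a universally
extremal-epimorphic family: after any base change, a monomorphism through which all of them
factor is split. -/
def Locally {T : C} (S : ∀ ⦃Y : C⦄, (Y ⟶ T) → Prop) : Prop :=
  ∀ ⦃Y N : C⦄ (y : Y ⟶ T) (n : N ⟶ Y), Mono n →
    (∀ ⦃W : C⦄ (w : W ⟶ Y), S (w ≫ y) → FactorsThru w n) → FactorsThru (𝟙 Y) n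

lemma Locally.of_forall {T : C} {S : ∀ ⦃Y : C⦄, (Y ⟶ T) → Prop}
    (h : ∀ ⦃Y : C⦄ (y : Y ⟶ T), S y) : Locally S :=
  fun _ _ _ _ _ hw => hw _ (h _)

lemma Locally.bind [HasPullbacks C] {T : C} {S R : ∀ ⦃Y : C⦄, (Y ⟶ T) → Prop} (hS : Locally S)
    (hR : ∀ ⦃Y : C⦄ (y : Y ⟶ T), S y → Locally (fun _ w => R (w ≫ y))) : Locally R := by
  intro Y N y n hn hw
  refine hS y n hn fun W w hSw => ?_
  obtain ⟨l, hl⟩ := hR _ hSw (𝟙 W) (pullback.snd n w) inferInstance fun V v hv => by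
    obtain ⟨k, hk⟩ := hw (v ≫ w) (by simpa using hv)
    exact ⟨pullback.lift k v hk, pullback.lift_snd _ _ _⟩
  exact ⟨l ≫ pullback.fst n w, by rw [Category.assoc, pullback.condition, reassoc_of% hl]⟩

lemma Locally.mono [HasPullbacks C] {T : C} {S R : ∀ ⦃Y : C⦄, (Y ⟶ T) → Prop} (hS : Locally S)
    (hR : ∀ ⦃Y : C⦄ (y : Y ⟶ T), S y → ∀ ⦃W : C⦄ (w : W ⟶ Y), R (w ≫ y)) : Locally R :=
  hS.bind fun _ y hy => .of_forall (hR y hy)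

/-- Generalized elements `a`, `b` are related by the span `(s, t)`. -/
def Related {E A B T : C} (s : E ⟶ A) (t : E ⟶ B) (a : T ⟶ A) (b : T ⟶ B) : Prop :=
  ∃ z : T ⟶ E, z ≫ s = a ∧ z ≫ t = b

lemma Related.precomp {E A B T T' : C} {s : E ⟶ A} {t : E ⟶ B} {a : T ⟶ A} {b : T ⟶ B}
    (h : Related s t a b) (w : T' ⟶ T) : Related s t (w ≫ a) (w ≫ b) := by
  obtain ⟨z, rfl, rfl⟩ := h
  exact ⟨w ≫ z, by simp, by simp⟩

/-- The universal property of the product, in terms of `JointlyMonic` and `Related`. -/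
lemma exists_product [HasFiniteLimits C] (A B : C) : ∃ (P : C) (p : P ⟶ A) (q : P ⟶ B),
    JointlyMonic p q ∧ ∀ ⦃T : C⦄ (a : T ⟶ A) (b : T ⟶ B), Related p q a b :=
  ⟨A ⨯ B, prod.fst, prod.snd, fun _ _ _ h₁ h₂ => Limits.prod.hom_ext h₁ h₂,
    fun _ a b => ⟨prod.lift a b, prod.lift_fst _ _, prod.lift_snd _ _⟩⟩

/-- Membership in a relation is a local property. -/
lemma Locally.related [HasFiniteLimits C] {T E A B : C} {s : E ⟶ A} {t : E ⟶ B}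
    (hst : JointlyMonic s t) {a : T ⟶ A} {b : T ⟶ B}
    (h : Locally (fun _ (w : _ ⟶ T) => Related s t (w ≫ a) (w ≫ b))) : Related s t a b := by
  obtain ⟨P, p, q, hpq, hP⟩ := exists_product A B
  obtain ⟨m, rfl, rfl⟩ := hP s t
  obtain ⟨c, rfl, rfl⟩ := hP a b
  have hm : Mono m := ⟨fun u w e => hst u w (by simp [reassoc_of% e]) (by simp [reassoc_of% e])⟩
  obtain ⟨l, hl⟩ := h (𝟙 T) (pullback.snd m c) inferInstance fun W w ⟨z, h₁, h₂⟩ =>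
    ⟨pullback.lift z w (hpq _ _ (by simpa using h₁) (by simpa using h₂)), pullback.lift_snd _ _ _⟩
  refine ⟨l ≫ pullback.fst m c, ?_, ?_⟩ <;> simp [pullback.condition_assoc, reassoc_of% hl]

/-- Equality of morphisms is a local property. -/
lemma Locally.eq [HasFiniteLimits C] {T A : C} {a b : T ⟶ A}
    (h : Locally (fun _ (w : _ ⟶ T) => w ≫ a = w ≫ b)) : a = b := by
  have hj : JointlyMonic (𝟙 A) (𝟙 A) := fun _ u w h _ => by simpa using h
  obtain ⟨z, h₁, h₂⟩ := Locally.related hj (a := a) (b := b)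
    (h.mono fun Y y hy W w => ⟨w ≫ y ≫ a, by simp, by simp [hy]⟩)
  rw [← h₁, ← h₂]

/-- Every generalized element of the target of a regular epimorphism lifts locally. -/
lemma locally_exists_lift [Regular C] {X Y T : C} (p : X ⟶ Y) [IsRegularEpi p] (a : T ⟶ Y) :
    Locally (fun W (w : W ⟶ T) => ∃ x : W ⟶ X, x ≫ p = w ≫ a) := by
  intro V N y n hn h
  obtain ⟨l, hl⟩ := h (pullback.snd p (y ≫ a))
    ⟨pullback.fst p (y ≫ a), by simp [pullback.condition]⟩
  have h₁ : StrongEpi (l ≫ n) := by rw [hl]; infer_instance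
  have h₂ : StrongEpi n := strongEpi_of_strongEpi l n
  have := isIso_of_mono_of_strongEpi n
  exact ⟨inv n, by simp⟩

/-- The pullback of a commutative square along a morphism into its last vertex. -/
lemma exists_cube [HasPullbacks C] {Z A B D D' : C} {f : Z ⟶ A} {g : Z ⟶ B} {h : A ⟶ D}
    {k : B ⟶ D} (w : f ≫ h = g ≫ k) (d : D' ⟶ D) :
    ∃ (Z' A' B' : C) (f' : Z' ⟶ A') (g' : Z' ⟶ B') (h' : A' ⟶ D') (k' : B' ⟶ D')
      (αZ : Z' ⟶ Z) (αA : A' ⟶ A) (αB : B' ⟶ B),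
      IsPullback f' αZ αA f ∧ IsPullback g' αZ αB g ∧ IsPullback h' αA d h ∧
      IsPullback k' αB d k ∧ f' ≫ h' = g' ≫ k' := by
  have hA : IsPullback (pullback.fst d h) (pullback.snd d h) d h := .of_hasPullback _ _
  have hB : IsPullback (pullback.fst d k) (pullback.snd d k) d k := .of_hasPullback _ _
  have hZ : IsPullback (pullback.fst d (f ≫ h)) (pullback.snd d (f ≫ h)) d (f ≫ h) :=
    .of_hasPullback _ _
  have hZ' : IsPullback (pullback.fst d (f ≫ h)) (pullback.snd d (f ≫ h)) d (g ≫ k) := w ▸ hZ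
  exact ⟨_, _, _, _, _, _, _, _, _, _, .of_right' hZ hA, .of_right' hZ' hB, hA, hB, by simp⟩

/-- Every generalized element of a stable pushout lies locally in one of the two summands. -/
lemma PushoutStable.locally [HasPullbacks C] {Z A B D T : C} {f : Z ⟶ A} {g : Z ⟶ B} {h : A ⟶ D}
    {k : B ⟶ D} (w : f ≫ h = g ≫ k) (hs : PushoutStable f g h k) (a : T ⟶ D) :
    Locally (fun W (w : W ⟶ T) =>
      (∃ x : W ⟶ A, x ≫ h = w ≫ a) ∨ (∃ x : W ⟶ B, x ≫ k = w ≫ a)) := by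
  intro V N y n hn H
  obtain ⟨Z', A', B', f', g', h', k', αZ, αA, αB, pf, pg, ph, pk, e⟩ := exists_cube w (y ≫ a)
  have hp := hs f' g' h' k' αZ αA αB _ pf pg ph pk e
  obtain ⟨l, hl⟩ := H h' (.inl ⟨αA, by simpa using ph.w.symm⟩)
  obtain ⟨m, hm⟩ := H k' (.inr ⟨αB, by simpa using pk.w.symm⟩)
  have hlm : f' ≫ l = g' ≫ m := by
    rw [← cancel_mono n, Category.assoc, Category.assoc, hl, hm, e]
  refine ⟨hp.desc l m hlm, hp.hom_ext ?_ ?_⟩ <;> simp [hl, hm]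

end Coverage

section StablePushouts

variable {C : Type u} [Category.{v} C]

/-- A stable pushout square which is also a pullback. -/
structure IsStablePushout {Z A B D : C} (f : Z ⟶ A) (g : Z ⟶ B) (h : A ⟶ D) (k : B ⟶ D) :
    Prop where
  isPushout : IsPushout f g h k
  stable : PushoutStable f g h k
  isPullback : IsPullback f g h k

lemma PushoutStable.flip {Z A B D : C} {f : Z ⟶ A} {g : Z ⟶ B} {h : A ⟶ D} {k : B ⟶ D}
    (hs : PushoutStable f g h k) : PushoutStable g f k h :=
  fun _ _ _ _ f' g' h' k' αZ αA αB αD pf pg ph pk e =>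
    (hs g' f' k' h' αZ αB αA αD pg pf pk ph e.symm).flip

lemma IsStablePushout.flip {Z A B D : C} {f : Z ⟶ A} {g : Z ⟶ B} {h : A ⟶ D} {k : B ⟶ D}
    (hs : IsStablePushout f g h k) : IsStablePushout g f k h :=
  ⟨hs.isPushout.flip, hs.stable.flip, hs.isPullback.flip⟩

lemma IsStablePushout.paste_horiz [HasPullbacks C] {X Y Z X₂ Y₂ Z₂ : C} {f₁ : X ⟶ Y} {e₁ : Y ⟶ Z}
    {g₁ : X ⟶ X₂} {g₂ : Y ⟶ Y₂} {g₃ : Z ⟶ Z₂} {f₂ : X₂ ⟶ Y₂} {e₂ : Y₂ ⟶ Z₂}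
    (hl : IsStablePushout f₁ g₁ g₂ f₂) (hr : IsStablePushout e₁ g₂ g₃ e₂) :
    IsStablePushout (f₁ ≫ e₁) g₁ g₃ (f₂ ≫ e₂) := by
  refine ⟨hl.isPushout.paste_horiz hr.isPushout, ?_, hl.isPullback.paste_horiz hr.isPullback⟩
  intro X' Z' X₂' Z₂' f' g' h' k' αX αZ αX₂ αZ₂ pf pg ph pk e
  obtain ⟨Y', Z'', Y₂', e₁', g₂', g₃', e₂', αY, αZ'', αY₂, pe₁, pg₂, pg₃, pe₂, e'⟩ :=
    exists_cube hr.isPushout.w αZ₂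
  obtain ⟨i, hi₁, hi₂⟩ : ∃ i : Z'' ≅ Z', i.hom ≫ h' = g₃' ∧ i.hom ≫ αZ = αZ'' :=
    ⟨pg₃.isoIsPullback _ _ ph, by simp, by simp⟩
  have pe₁' : IsPullback (e₁' ≫ i.hom) αY αZ e₁ := by
    refine pe₁.of_iso (Iso.refl _) i (Iso.refl _) (Iso.refl _) ?_ ?_ ?_ ?_ <;> simp [hi₂]
  have e'' : (e₁' ≫ i.hom) ≫ h' = g₂' ≫ e₂' := by simp [hi₁, e']
  have q₁ := IsPullback.of_right' pf pe₁'
  have q₂ := IsPullback.of_right' pk pe₂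
  have hr' := hr.stable _ _ _ _ _ _ _ _ pe₁' pg₂ ph pe₂ e''
  set a := pe₁'.lift f' (αX ≫ f₁) (by rw [pf.w, Category.assoc])
  have ha₁ : a ≫ e₁' ≫ i.hom = f' := pe₁'.lift_fst _ _ _
  have ha₂ : a ≫ αY = αX ≫ f₁ := pe₁'.lift_snd _ _ _
  set b := pe₂.lift k' (αX₂ ≫ f₂) (by rw [pk.w, Category.assoc])
  have hb₁ : b ≫ e₂' = k' := pe₂.lift_fst _ _ _
  have hb₂ : b ≫ αY₂ = αX₂ ≫ f₂ := pe₂.lift_snd _ _ _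
  have hl' := hl.stable a g' g₂' b αX αY αX₂ αY₂ q₁ pg pg₂ q₂ <| pe₂.hom_ext
    (by simp only [Category.assoc, hb₁, ← e, ← ha₁, ← e''])
    (by simp only [Category.assoc, hb₂, pg₂.w, reassoc_of% ha₂, reassoc_of% pg.w,
        hl.isPushout.w])
  have := hl'.paste_horiz hr'
  rwa [ha₁, hb₁] at this

/-- Being a stable pushout only depends on the span. -/
lemma IsStablePushout.of_isPushout {Z A B D D₀ : C} {f : Z ⟶ A} {g : Z ⟶ B} {h : A ⟶ D}
    {k : B ⟶ D} {h₀ : A ⟶ D₀} {k₀ : B ⟶ D₀} (hs : IsStablePushout f g h₀ k₀)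
    (hp : IsPushout f g h k) : IsStablePushout f g h k := by
  obtain ⟨i, rfl, rfl⟩ : ∃ i : D₀ ≅ D, h₀ ≫ i.hom = h ∧ k₀ ≫ i.hom = k :=
    ⟨hs.isPushout.isoIsPushout _ _ hp, by simp, by simp⟩
  refine ⟨hp, ?_, hs.isPullback.of_iso (.refl _) (.refl _) (.refl _) i ?_ ?_ ?_ ?_⟩
  · intro Z' A' B' D' f' g' h' k' αZ αA αB αD pf pg ph pk e
    refine hs.stable f' g' h' k' αZ αA αB (αD ≫ i.inv) pf pg ?_ ?_ e
    · refine ph.of_iso (.refl _) (.refl _) (.refl _) i.symm ?_ ?_ ?_ ?_ <;> simp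
    · refine pk.of_iso (.refl _) (.refl _) (.refl _) i.symm ?_ ?_ ?_ ?_ <;> simp
  all_goals simp

end StablePushouts

section MalcevSpans

variable {C : Type u} [Category.{v} C]

lemma isMalcevSpan_iff [HasPullbacks C] {Z A B : C} {f : Z ⟶ A} {g : Z ⟶ B} :
    IsMalcevSpan f g ↔ JointlyMonic f g ∧ ∀ ⦃T : C⦄ (z₁ z₂ z₃ : T ⟶ Z),
      z₁ ≫ g = z₂ ≫ g → z₂ ≫ f = z₃ ≫ f → Related f g (z₁ ≫ f) (z₃ ≫ g) := by
  refine and_congr_right fun _ => ⟨fun h T z₁ z₂ z₃ h₁ h₂ => ?_, fun h P π₁ π₂ π₃ hP =>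
    h π₁ π₂ π₃ hP.w₁ hP.w₂⟩
  have p : IsPullback (pullback.fst g g) (pullback.snd g g) g g := .of_hasPullback g g
  have q : IsPullback (pullback.fst (pullback.snd g g ≫ f) f)
    (pullback.snd (pullback.snd g g ≫ f) f) (pullback.snd g g ≫ f) f := .of_hasPullback _ _
  have hP : IsTripleLimit f g (pullback.fst (pullback.snd g g ≫ f) f ≫ pullback.fst g g)
      (pullback.fst (pullback.snd g g ≫ f) f ≫ pullback.snd g g)
      (pullback.snd (pullback.snd g g ≫ f) f) := by
    refine ⟨by simp [p.w], by simp [q.w], fun X x₁ x₂ x₃ e₁ e₂ => ?_⟩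
    obtain ⟨y, rfl, rfl⟩ := p.exists_lift x₁ x₂ e₁
    obtain ⟨x, rfl, rfl⟩ := q.exists_lift y x₃ (by simpa using e₂)
    refine ⟨x, by simp, fun x' ⟨h₁, h₂, h₃⟩ => q.hom_ext (p.hom_ext ?_ ?_) h₃⟩
    · rw [Category.assoc, h₁]
    · rw [Category.assoc, h₂]
  obtain ⟨m, hm₁, hm₂⟩ := h _ _ _ hP
  obtain ⟨u, ⟨rfl, rfl, rfl⟩, -⟩ := hP.lift z₁ z₂ z₃ h₁ h₂
  exact ⟨u ≫ m, by simp [hm₁], by simp [hm₂]⟩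

lemma isMalcevSpan_of_mono {Z A B : C} (f : Z ⟶ A) (g : Z ⟶ B) [Mono f] : IsMalcevSpan f g := by
  refine ⟨fun _ u v h _ => (cancel_mono f).1 h, fun P π₁ π₂ π₃ hP => ⟨π₁, rfl, ?_⟩⟩
  rw [hP.w₁, (cancel_mono f).1 hP.w₂]

end MalcevSpans

section RegularCategories

variable {C : Type u} [Category.{v} C]

lemma BarrExact.regular [HasFiniteLimits C] (hC : BarrExact C) : Regular C where
  hasCoequalizer_of_isKernelPair {X Y Z f g₁ g₂} h := by
    obtain ⟨i, rfl, rfl⟩ : ∃ i : Z ≅ pullback f f,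
        i.hom ≫ pullback.fst f f = g₁ ∧ i.hom ≫ pullback.snd f f = g₂ :=
      ⟨h.isoPullback, by simp, by simp⟩
    have := hC.1 f
    exact ⟨⟨⟨_, isCoequalizerEpiComp (colimit.isColimit _) i.hom⟩⟩⟩
  regularEpiIsStableUnderBaseChange.of_isPullback {X Y Y' S f g f' g'} h hg := by
    obtain ⟨hr⟩ := hC.2.1 g f hg.regularEpi
    have e : Arrow.mk (pullback.snd g f) ≅ Arrow.mk g' :=
      Arrow.isoMk h.isoPullback.symm (Iso.refl _) (by simp)
    exact ⟨⟨hr.ofArrowIso e⟩⟩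

lemma exists_image [Regular C] {X Y : C} (f : X ⟶ Y) :
    ∃ (I : C) (e : X ⟶ I) (m : I ⟶ Y), IsRegularEpi e ∧ Mono m ∧ e ≫ m = f :=
  ⟨_, (Regular.strongEpiMonoFactorisation f).e, (Regular.strongEpiMonoFactorisation f).m,
    inferInstance, inferInstance, (Regular.strongEpiMonoFactorisation f).fac⟩

lemma isRegularEpi_of_isPullback [Regular C] {P X Y S : C} {p : P ⟶ X} {q : P ⟶ Y} {f : X ⟶ S}
    {g : Y ⟶ S} (h : IsPullback p q f g) [hg : IsRegularEpi g] : IsRegularEpi p :=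
  Regular.regularEpiIsStableUnderBaseChange.of_isPullback h.flip hg

lemma IsRegularEpi.exists_desc {X Y W : C} (f : X ⟶ Y) [IsRegularEpi f] (u : X ⟶ W)
    (h : ∀ ⦃T : C⦄ (x₁ x₂ : T ⟶ X), x₁ ≫ f = x₂ ≫ f → x₁ ≫ u = x₂ ≫ u) :
    ∃ v : Y ⟶ W, f ≫ v = u :=
  ⟨_, IsRegularEpi.fac f u (h _ _ (IsRegularEpi.w f))⟩

/-- Any two morphisms with a common target have a union, whose generalized elements lie locally
in the image of one of the two. -/
lemma exists_union [Regular C] (hC : Amalgamable C) {U V X : C} (a : U ⟶ X) (b : V ⟶ X) :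
    ∃ (P : C) (m : P ⟶ X), Mono m ∧ FactorsThru a m ∧ FactorsThru b m ∧
      ∀ ⦃T : C⦄ (x : T ⟶ X), FactorsThru x m →
        Locally (fun W (w : W ⟶ T) => FactorsThru (w ≫ x) a ∨ FactorsThru (w ≫ x) b) := by
  obtain ⟨I, e, i, _, _, rfl⟩ := exists_image a
  obtain ⟨J, e', j, _, _, rfl⟩ := exists_image b
  obtain ⟨E, h, k, hp, hs, -⟩ := hC (pullback.fst i j) (pullback.snd i j) inferInstance
    inferInstance
  obtain ⟨d, rfl, rfl⟩ := hp.exists_desc i j pullback.condition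
  obtain ⟨P, c, m, _, _, rfl⟩ := exists_image d
  refine ⟨P, m, inferInstance, ⟨e ≫ h ≫ c, by simp⟩, ⟨e' ≫ k ≫ c, by simp⟩, ?_⟩
  rintro T _ ⟨x, rfl⟩
  refine (locally_exists_lift c x).bind fun Y y ⟨x', hx'⟩ => ?_
  refine (hs.locally hp.w x').bind fun Y' y' hy' => ?_
  obtain ⟨z, hz⟩ | ⟨z, hz⟩ := hy'
  · refine (locally_exists_lift e z).mono fun W w ⟨z', hz'⟩ W' w' => .inl ⟨w' ≫ z', ?_⟩
    simp [reassoc_of% hz', reassoc_of% hz, reassoc_of% hx']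
  · refine (locally_exists_lift e' z).mono fun W w ⟨z', hz'⟩ W' w' => .inr ⟨w' ≫ z', ?_⟩
    simp [reassoc_of% hz', reassoc_of% hz, reassoc_of% hx']

/-- The reflexive closure of the relation given by the image of a pair of parallel morphisms. -/
lemma exists_reflexive_closure [Regular C] (hC : Amalgamable C) {K A : C} (s₀ t₀ : K ⟶ A) :
    ∃ (E : C) (s t : E ⟶ A), JointlyMonic s t ∧ Related s t s₀ t₀ ∧ Related s t (𝟙 A) (𝟙 A) ∧
      ∀ ⦃T : C⦄ (a b : T ⟶ A), Related s t a b →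
        Locally (fun W (w : W ⟶ T) => w ≫ a = w ≫ b ∨ Related s₀ t₀ (w ≫ a) (w ≫ b)) := by
  obtain ⟨P, p, q, hpq, hP⟩ := exists_product A A
  obtain ⟨φ, rfl, rfl⟩ := hP s₀ t₀
  obtain ⟨δ, hδ₁, hδ₂⟩ := hP (𝟙 A) (𝟙 A)
  obtain ⟨E, m, _, ⟨x, hx⟩, ⟨r, hr⟩, hE⟩ := exists_union hC φ δ
  refine ⟨E, m ≫ p, m ≫ q, fun X u v h₁ h₂ => ?_, ⟨x, ?_, ?_⟩, ⟨r, ?_, ?_⟩, ?_⟩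
  · exact (cancel_mono m).1 (hpq _ _ (by simpa using h₁) (by simpa using h₂))
  · rw [reassoc_of% hx]
  · rw [reassoc_of% hx]
  · rw [reassoc_of% hr, hδ₁]
  · rw [reassoc_of% hr, hδ₂]
  · rintro T _ _ ⟨z, rfl, rfl⟩
    refine (hE (z ≫ m) ⟨z, rfl⟩).mono fun Y y hy W w => ?_
    obtain ⟨u, hu⟩ | ⟨u, hu⟩ := hy
    · exact .inr ⟨w ≫ u, by simp [reassoc_of% hu], by simp [reassoc_of% hu]⟩
    · refine .inl ?_
      have h₁ := hu =≫ p
      have h₂ := hu =≫ q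
      simp only [Category.assoc, hδ₁, hδ₂, Category.comp_id] at h₁ h₂
      rw [Category.assoc, Category.assoc, ← h₁, ← h₂]

/-- In a Barr-exact category, an equivalence relation is the kernel pair of its quotient. -/
lemma exists_quotient [Regular C]
    (hC : ∀ ⦃E A : C⦄ (s t : E ⟶ A), IsEquivRelation s t →
      ∃ (Q : C) (q : A ⟶ Q), IsPullback s t q q)
    {E A : C} {s t : E ⟶ A} (hm : JointlyMonic s t) (hr : Related s t (𝟙 A) (𝟙 A))
    (hs : ∀ ⦃T : C⦄ (a b : T ⟶ A), Related s t a b → Related s t b a)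
    (ht : ∀ ⦃T : C⦄ (a b c : T ⟶ A), Related s t a b → Related s t b c → Related s t a c) :
    ∃ (Q : C) (q : A ⟶ Q), IsRegularEpi q ∧ IsPullback s t q q := by
  obtain ⟨Q, q, hq⟩ := hC s t ⟨hm, hr, hs s t ⟨𝟙 E, by simp, by simp⟩,
    ht _ _ _ ⟨pullback.fst t s, rfl, rfl⟩ ⟨pullback.snd t s, pullback.condition.symm, rfl⟩⟩
  obtain ⟨I, e, m, he, _, rfl⟩ := exists_image q
  refine ⟨I, e, he, .mk' ?_ (fun T u v => hm u v) fun T a b h => ?_⟩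
  · simpa [← cancel_mono m] using hq.w
  · exact hq.exists_lift a b (by rw [reassoc_of% h])

lemma mono_of_isPullback_of_mono [Regular C] {Z A B D : C} {f : Z ⟶ A} {g : Z ⟶ B} {h : A ⟶ D}
    {k : B ⟶ D} (hp : IsPullback f g h k) [Mono f] [IsRegularEpi g] : Mono k where
  right_cancellation {T} u v huv := by
    refine ((locally_exists_lift g u).mono fun Y y ⟨z, hz⟩ W w => ?_).eq
    obtain ⟨l, hl₁, hl₂⟩ := hp.exists_lift (z ≫ f) (y ≫ v)
      (by rw [Category.assoc, hp.w, reassoc_of% hz, huv, Category.assoc])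
    rw [cancel_mono] at hl₁
    rw [Category.assoc, Category.assoc, ← hz, ← hl₂, hl₁]

/-- The condition that the kernel pair of `h` is locally generated by the image under `f` of the
kernel pair of `g`. -/
def KernelPairGenerated {Z A B D : C} (f : Z ⟶ A) (g : Z ⟶ B) (h : A ⟶ D) : Prop :=
  ∀ ⦃T : C⦄ (x₁ x₂ : T ⟶ A), x₁ ≫ h = x₂ ≫ h →
    Locally (fun W (w : W ⟶ T) => w ≫ x₁ = w ≫ x₂ ∨
      ∃ z₁ z₂ : W ⟶ Z, z₁ ≫ f = w ≫ x₁ ∧ z₂ ≫ f = w ≫ x₂ ∧ z₁ ≫ g = z₂ ≫ g)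

lemma KernelPairGenerated.isPushout [Regular C] {Z A B D : C} {f : Z ⟶ A} {g : Z ⟶ B} {h : A ⟶ D}
    {k : B ⟶ D} (hK : KernelPairGenerated f g h) (w : f ≫ h = g ≫ k) [IsRegularEpi h]
    [IsRegularEpi g] : IsPushout f g h k := by
  refine .mk' w (fun T φ φ' h₁ _ => (cancel_epi h).1 h₁) fun T a b hab => ?_
  obtain ⟨l, rfl⟩ := IsRegularEpi.exists_desc h a fun V x₁ x₂ hx => by
    refine ((hK x₁ x₂ hx).mono fun Y y hy W w => ?_).eq
    obtain hy | ⟨z₁, z₂, h₁, h₂, hz⟩ := hy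
    · simp [reassoc_of% hy]
    · rw [Category.assoc, Category.assoc, ← reassoc_of% h₁, ← reassoc_of% h₂, hab, reassoc_of% hz]
  exact ⟨l, rfl, by rw [← cancel_epi g, ← reassoc_of% w, hab]⟩

lemma KernelPairGenerated.isStablePushout [Regular C] {Z A B D : C} {f : Z ⟶ A} {g : Z ⟶ B}
    {h : A ⟶ D} {k : B ⟶ D} (hK : KernelPairGenerated f g h) (hp : IsPullback f g h k)
    [IsRegularEpi h] [IsRegularEpi g] : IsStablePushout f g h k := by
  refine ⟨hK.isPushout hp.w, ?_, hp⟩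
  intro Z' A' B' D' f' g' h' k' αZ αA αB αD pf pg ph pk e
  have := isRegularEpi_of_isPullback ph
  have := isRegularEpi_of_isPullback pg
  refine KernelPairGenerated.isPushout (fun T x₁ x₂ hx => ?_) e
  refine (hK (x₁ ≫ αA) (x₂ ≫ αA) ?_).mono fun Y y hy W w => ?_
  · rw [Category.assoc, Category.assoc, ← ph.w, reassoc_of% hx]
  · obtain hy | ⟨z₁, z₂, h₁, h₂, hz⟩ := hy
    · refine .inl ?_
      rw [Category.assoc, Category.assoc,
        ph.hom_ext (k := y ≫ x₁) (l := y ≫ x₂) (by simp [hx]) (by simpa using hy)]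
    · refine .inr ?_
      obtain ⟨u₁, hu₁, rfl⟩ := pf.exists_lift (y ≫ x₁) z₁ (by simp [h₁])
      obtain ⟨u₂, hu₂, rfl⟩ := pf.exists_lift (y ≫ x₂) z₂ (by simp [h₂])
      refine ⟨w ≫ u₁, w ≫ u₂, by simp [hu₁], by simp [hu₂], ?_⟩
      rw [Category.assoc, Category.assoc, pk.hom_ext (k := u₁ ≫ g') (l := u₂ ≫ g')]
      · simp only [Category.assoc, ← e, reassoc_of% hu₁, reassoc_of% hu₂, hx]
      · simpa [pg.w] using hz

end RegularCategories

section Diexactness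

variable {C : Type u} [Category.{v} C]

/-- A Mal'cev span with one leg a regular epimorphism has a stable pushout. -/
lemma exists_isStablePushout_of_isRegularEpi [Regular C]
    (hE : ∀ ⦃E A : C⦄ (s t : E ⟶ A), IsEquivRelation s t →
      ∃ (Q : C) (q : A ⟶ Q), IsPullback s t q q)
    (hC : Amalgamable C) {Z A B : C} {f : Z ⟶ A} {g : Z ⟶ B} [IsRegularEpi g]
    (hfg : IsMalcevSpan f g) :
    ∃ (D : C) (h : A ⟶ D) (k : B ⟶ D), IsStablePushout f g h k := by
  obtain ⟨hj, hM⟩ := isMalcevSpan_iff.1 hfg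
  obtain ⟨E, s, t, hm, hK, hr, hloc⟩ :=
    exists_reflexive_closure hC (pullback.fst g g ≫ f) (pullback.snd g g ≫ f)
  have hrefl {T : C} (a : T ⟶ A) : Related s t a a := by simpa using hr.precomp a
  have hker {T : C} {z₁ z₂ : T ⟶ Z} (hz : z₁ ≫ g = z₂ ≫ g) : Related s t (z₁ ≫ f) (z₂ ≫ f) := by
    have := hK.precomp (pullback.lift z₁ z₂ hz)
    rwa [pullback.lift_fst_assoc, pullback.lift_snd_assoc] at this
  have hloc' {T : C} (a b : T ⟶ A) (hab : Related s t a b) :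
      Locally (fun W (w : W ⟶ T) => w ≫ a = w ≫ b ∨
        ∃ z₁ z₂ : W ⟶ Z, z₁ ≫ f = w ≫ a ∧ z₂ ≫ f = w ≫ b ∧ z₁ ≫ g = z₂ ≫ g) := by
    refine (hloc a b hab).mono fun Y y hy W w => ?_
    obtain hy | ⟨u, h₁, h₂⟩ := hy
    · exact .inl (by simp [hy])
    · exact .inr ⟨w ≫ u ≫ pullback.fst g g, w ≫ u ≫ pullback.snd g g, by simp [← h₁],
        by simp [← h₂], by simp [pullback.condition]⟩
  have hsymm {T : C} (a b : T ⟶ A) (hab : Related s t a b) : Related s t b a := by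
    refine ((hloc' a b hab).mono fun Y y hy W w => ?_).related hm
    rw [Category.assoc, Category.assoc]
    refine Related.precomp ?_ w
    obtain hy | ⟨z₁, z₂, h₁, h₂, hz⟩ := hy
    · rw [hy]
      exact hrefl _
    · rw [← h₁, ← h₂]
      exact hker hz.symm
  have htrans {T : C} (a b c : T ⟶ A) (hab : Related s t a b) (hbc : Related s t b c) :
      Related s t a c := by
    refine ((hloc' a b hab).bind fun Y y hy => ?_).related hm
    refine (hloc' (y ≫ b) (y ≫ c) (hbc.precomp y)).mono fun Y' y' hy' W w => ?_
    simp only [Category.assoc]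
    refine Related.precomp ?_ w
    obtain hy | ⟨z₁, z₂, h₁, h₂, hz⟩ := hy
    · rw [hy]
      exact (hbc.precomp y).precomp y'
    · obtain hy' | ⟨z₃, z₄, h₃, h₄, hz'⟩ := hy'
      · rw [← hy']
        exact (hab.precomp y).precomp y'
      · obtain ⟨z, h₅, h₆⟩ := hM (y' ≫ z₁) (y' ≫ z₂) z₃ (by simp [hz]) (by simp [h₂, h₃])
        rw [← h₄, ← h₁, ← Category.assoc y', ← h₅]
        exact hker (h₆.trans hz')
  obtain ⟨D, h, hh, hp⟩ := exists_quotient hE hm hr (fun _ => hsymm) (fun _ => htrans)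
  have heff {T : C} {a b : T ⟶ A} (hab : a ≫ h = b ≫ h) : Related s t a b :=
    hp.exists_lift a b hab
  obtain ⟨k, hk⟩ := IsRegularEpi.exists_desc g (f ≫ h) fun T z₁ z₂ hz => by
    obtain ⟨u, h₁, h₂⟩ := hker hz
    rw [← reassoc_of% h₁, ← reassoc_of% h₂, hp.w]
  refine ⟨D, h, k, KernelPairGenerated.isStablePushout
    (fun T x₁ x₂ hx => hloc' x₁ x₂ (heff hx)) (.mk' hk.symm (fun T u v => hj u v) ?_)⟩
  intro T a b hab
  refine ((locally_exists_lift g b).bind fun Y y ⟨z, hz⟩ => ?_).related hj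
  refine (hloc' (y ≫ a) (z ≫ f) (heff ?_)).mono fun Y' y' hy' W w => ?_
  · rw [Category.assoc, Category.assoc, hab, ← hk, reassoc_of% hz]
  · simp only [Category.assoc]
    refine Related.precomp ?_ w
    obtain hy' | ⟨z₁, z₂, h₁, h₂, hz'⟩ := hy'
    · exact ⟨y' ≫ z, by simp [hy'], by simp [hz]⟩
    · have := hM z₁ z₂ (y' ≫ z) hz' (by simpa using h₂)
      simpa [h₁, hz] using this

/-- In a Barr-exact amalgamable category, every Mal'cev span has a stable pushout. -/
lemma exists_isStablePushout [Regular C]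
    (hE : ∀ ⦃E A : C⦄ (s t : E ⟶ A), IsEquivRelation s t →
      ∃ (Q : C) (q : A ⟶ Q), IsPullback s t q q)
    (hC : Amalgamable C) {Z A B : C} {f : Z ⟶ A} {g : Z ⟶ B} (hfg : IsMalcevSpan f g) :
    ∃ (D : C) (h : A ⟶ D) (k : B ⟶ D), IsStablePushout f g h k := by
  obtain ⟨B₀, d, n, _, _, rfl⟩ := exists_image g
  have hfd : IsMalcevSpan f d := by
    obtain ⟨hj, hM⟩ := isMalcevSpan_iff.1 hfg
    refine isMalcevSpan_iff.2 ⟨fun X u v h₁ h₂ => hj u v h₁ (by simp [reassoc_of% h₂]), ?_⟩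
    intro T z₁ z₂ z₃ h₁ h₂
    obtain ⟨z, hz₁, hz₂⟩ := hM z₁ z₂ z₃ (by simp [reassoc_of% h₁]) h₂
    exact ⟨z, hz₁, by simpa [← cancel_mono n] using hz₂⟩
  obtain ⟨D₁, h₁, k₁, sq₁⟩ := exists_isStablePushout_of_isRegularEpi hE hC hfd
  obtain ⟨Q, e, m, _, _, rfl⟩ := exists_image k₁
  obtain ⟨D₂, h₂, k₂, sq₂⟩ :=
    exists_isStablePushout_of_isRegularEpi hE hC (isMalcevSpan_of_mono n e)
  obtain ⟨D, h₃, k₃, hp, hs, hq⟩ := hC m k₂ inferInstance (mono_of_isPullback_of_mono sq₂.isPullback)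
  exact ⟨D, _, _, (sq₁.flip.paste_horiz (sq₂.flip.paste_horiz ⟨hp, hs, hq⟩).flip).flip⟩

lemma IsEquivRelation.related_trans [HasPullbacks C] {E A : C} {s t : E ⟶ A}
    (h : IsEquivRelation s t) {T : C} {a b c : T ⟶ A} (hab : Related s t a b)
    (hbc : Related s t b c) : Related s t a c := by
  obtain ⟨-, -, -, τ, hτ₁, hτ₂⟩ := h
  obtain ⟨x, rfl, rfl⟩ := hab
  obtain ⟨y, hxy, rfl⟩ := hbc
  refine ⟨pullback.lift x y hxy.symm ≫ τ, ?_, ?_⟩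
  · rw [Category.assoc, hτ₁, pullback.lift_fst_assoc]
  · rw [Category.assoc, hτ₂, pullback.lift_snd_assoc]

lemma IsEquivRelation.isMalcevSpan [HasPullbacks C] {E A : C} {s t : E ⟶ A}
    (h : IsEquivRelation s t) : IsMalcevSpan s t := by
  obtain ⟨σ, hσ₁, hσ₂⟩ := h.2.2.1
  refine isMalcevSpan_iff.2 ⟨h.1, fun T z₁ z₂ z₃ h₁ h₂ => ?_⟩
  exact h.related_trans ⟨z₁, rfl, rfl⟩
    (h.related_trans ⟨z₂ ≫ σ, by simp [hσ₁, h₁], by simp [hσ₂]⟩ ⟨z₃, h₂.symm, rfl⟩)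

lemma isEquivRelation_kernelPair [HasPullbacks C] {X Y : C} (f : X ⟶ Y) :
    IsEquivRelation (pullback.fst f f) (pullback.snd f f) := by
  have hp : IsPullback (pullback.fst f f) (pullback.snd f f) f f := .of_hasPullback f f
  refine ⟨fun _ _ _ => hp.hom_ext, hp.exists_lift _ _ rfl, hp.exists_lift _ _ hp.w.symm,
    hp.exists_lift _ _ ?_⟩
  rw [Category.assoc, Category.assoc, hp.w, pullback.condition_assoc, hp.w]

/-- In a diexact category, an equivalence relation has an effective quotient. -/
lemma Diexact.exists_quotient [HasPullbacks C] (hC : Diexact C) {E A : C} {s t : E ⟶ A}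
    (h : IsEquivRelation s t) :
    ∃ (Q : C) (q : A ⟶ Q), IsPushout s t q q ∧ IsPullback s t q q := by
  obtain ⟨⟨Q, q, q', hp⟩, hs⟩ := hC s t h.isMalcevSpan
  obtain ⟨r, hr₁, hr₂⟩ := h.2.1
  obtain rfl : q = q' := by simpa [reassoc_of% hr₁, reassoc_of% hr₂] using r ≫= hp.w
  exact ⟨Q, q, hp, (hs q q hp).2⟩

lemma Diexact.amalgamable (hC : Diexact C) : Amalgamable C := by
  intro Z A B f g hf hg
  obtain ⟨⟨D, h, k, hp⟩, hs⟩ := hC f g (isMalcevSpan_of_mono f g)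
  exact ⟨D, h, k, hp, hs h k hp⟩

lemma CategoryTheory.IsPushout.nonempty_isColimit {E A Q : C} {s t : E ⟶ A} {q : A ⟶ Q}
    (hp : IsPushout s t q q) : Nonempty (IsColimit (Cofork.ofπ q hp.w)) :=
  ⟨Cofork.IsColimit.mk _ (fun c => hp.desc c.π c.π c.condition) (fun _ => hp.inl_desc _ _ _)
    (fun _ _ hm => hp.hom_ext (hm.trans (hp.inl_desc _ _ _).symm)
      (hm.trans (hp.inr_desc _ _ _).symm))⟩

lemma isPushout_kernelPair [HasPullbacks C] {X Y : C} (f : X ⟶ Y) [IsRegularEpi f] :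
    IsPushout (pullback.fst f f) (pullback.snd f f) f f := by
  have hp : IsPullback (pullback.fst f f) (pullback.snd f f) f f := .of_hasPullback f f
  refine .mk' hp.w (fun T φ φ' h _ => (cancel_epi f).1 h) fun T a b hab => ?_
  obtain ⟨r, hr₁, hr₂⟩ := hp.exists_lift (𝟙 X) (𝟙 X) rfl
  obtain rfl : a = b := by simpa [reassoc_of% hr₁, reassoc_of% hr₂] using r ≫= hab
  obtain ⟨l, rfl⟩ := IsRegularEpi.exists_desc f a fun V x₁ x₂ hx => by
    obtain ⟨x, rfl, rfl⟩ := hp.exists_lift x₁ x₂ hx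
    rw [Category.assoc, Category.assoc, hab]
  exact ⟨l, rfl, rfl⟩

lemma Diexact.barrExact [HasFiniteLimits C] (hC : Diexact C) : BarrExact C := by
  refine ⟨fun X Y f => ?_, fun X Y W f g hf => ?_, fun E A s t h => ?_⟩
  · obtain ⟨Q, q, hp, -⟩ := hC.exists_quotient (isEquivRelation_kernelPair f)
    obtain ⟨hq⟩ := hp.nonempty_isColimit
    exact ⟨⟨⟨_, hq⟩⟩⟩
  · have : IsRegularEpi f := ⟨hf⟩
    have hp := isPushout_kernelPair f
    have hA : IsPullback (pullback.snd f g) (pullback.fst f g) g f :=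
      (IsPullback.of_hasPullback f g).flip
    have hZ : IsPullback (pullback.fst g (pullback.fst f f ≫ f))
        (pullback.snd g (pullback.fst f f ≫ f)) g (pullback.fst f f ≫ f) := .of_hasPullback _ _
    have hZ' : IsPullback (pullback.fst g (pullback.fst f f ≫ f))
        (pullback.snd g (pullback.fst f f ≫ f)) g (pullback.snd f f ≫ f) := hp.w ▸ hZ
    have hp' := ((hC _ _ (isEquivRelation_kernelPair f).isMalcevSpan).2 _ _ hp).1 _ _ _ _ _ _ _ _
      (.of_right' hZ hA) (.of_right' hZ' hA) hA hA ((hA.lift_fst _ _ _).trans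
        (hA.lift_fst _ _ _).symm)
    obtain ⟨hq⟩ := hp'.nonempty_isColimit
    exact ⟨⟨_, _, _, hp'.w, hq⟩⟩
  · obtain ⟨Q, q, -, hq⟩ := hC.exists_quotient h
    exact ⟨Q, q, hq⟩

end Diexactness

/-- A finitely complete category is diexact if and only if it is
Barr-exact and amalgamable. -/
theorem diexact_iff_barrExact_amalgamable {C : Type u} [Category.{v} C]
    [HasFiniteLimits C] :
    Diexact C ↔ (BarrExact C ∧ Amalgamable C) := by
  refine ⟨fun h => ⟨h.barrExact, h.amalgamable⟩, fun ⟨hB, hA⟩ Z A B f g hfg => ?_⟩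
  have := hB.regular
  obtain ⟨D, h, k, hs⟩ := exists_isStablePushout hB.2.2 hA hfg
  refine ⟨⟨D, h, k, hs.isPushout⟩, fun D' h' k' hp => ?_⟩
  have := hs.of_isPushout hp
  exact ⟨this.stable, this.isPullback⟩
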